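/- In every associative dialgebra D over a commutative ring, the PATS satisfies the degree-7 identity 12·S = 0: for all a,b,c,d,e,f,g ∈ D, 3Σ₁ − 2Σ₂ + 3Σ₃ + Σ₄ − 2Σ₅ − Σ₆ = 0, where Σ₁ = Σ_{σ∈S₅} ε(σ)[[[a,bσ,cσ],dσ,g],eσ,fσ], Σ₂ = Σ_{σ∈S₅} ε(σ)[[a,[bσ,cσ,dσ],eσ],fσ,g], Σ₃ = Σ_{σ∈S₅} ε(σ)[[a,[bσ,cσ,g],dσ],eσ,fσ], Σ₄ = Σ_{σ∈S₅} ε(σ)[[a,bσ,cσ],[dσ,eσ,fσ],g], Σ₅ = Σ_{σ∈S₅} ε(σ)[a,[[bσ,cσ,dσ],eσ,g],fσ], with σ ranging over all permutations of (b,c,d,e,f) in Σ₁–Σ₅, and Σ₆ = Σ_{σ∈S₅} ε(σ)[a,[b,cσ,dσ],[eσ,fσ,gσ]] with σ ranging over all permutations of (c,d,e,f,g). -/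

import Mathlib

/-- An associative dialgebra over a commutative ring `k`: a `k`-module `D` with two
bilinear products `l` (left, `⊣`) and `r` (right, `⊢`) satisfying the five dialgebra axioms. -/
structure Dialgebra (k : Type*) (D : Type*) [CommRing k] [AddCommGroup D] [Module k D] where
  l : D →ₗ[k] D →ₗ[k] D
  r : D →ₗ[k] D →ₗ[k] D
  l_assoc : ∀ a b c : D, l (l a b) c = l a (l b c)
  r_assoc : ∀ a b c : D, r (r a b) c = r a (r b c)
  inner_assoc : ∀ a b c : D, l (r a b) c = r a (l b c)
  bar_right : ∀ a b c : D, r (l a b) c = r (r a b) c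
  bar_left : ∀ a b c : D, l a (l b c) = l a (r b c)

/-- The partially alternating ternary sum (PATS):
`[a,b,c] = a⊣b⊣c − a⊣c⊣b − (b⊢a)⊣c + (c⊢a)⊣b + b⊢(c⊢a) − c⊢(b⊢a)`. -/
def Dialgebra.pats {k D : Type*} [CommRing k] [AddCommGroup D] [Module k D]
    (A : Dialgebra k D) (a b c : D) : D :=
  A.l (A.l a b) c - A.l (A.l a c) b - A.l (A.r b a) c + A.l (A.r c a) b
    + A.r b (A.r c a) - A.r c (A.r b a)

section AlternatingSums

variable {D X : Type*} [AddCommGroup D]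

/-- Expansion of an alternating sum over permutations along the image of `0`. -/
theorem sum_sign_smul_perm_succ {n : ℕ} (F : Equiv.Perm (Fin (n + 1)) → D) :
    ∑ σ, (Equiv.Perm.sign σ : ℤ) • F σ =
      ∑ p : Fin (n + 1), (if p = 0 then 1 else -1 : ℤ) •
        ∑ e : Equiv.Perm (Fin n), (Equiv.Perm.sign e : ℤ) •
          F (Equiv.Perm.decomposeFin.symm (p, e)) := by
  rw [← Equiv.Perm.decomposeFin.symm.sum_comp, Fintype.sum_prod_type]
  refine Finset.sum_congr rfl fun p _ => ?_
  rw [Finset.smul_sum]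
  refine Finset.sum_congr rfl fun e _ => ?_
  rw [Equiv.Perm.decomposeFin.symm_sign, smul_smul]
  split_ifs <;> simp

/-- The alternating sum of `F` over the orderings of three arguments. -/
def alt₃ (F : X → X → X → D) (x y z : X) : D :=
  F x y z - F x z y - F y x z + F y z x + F z x y - F z y x

/-- The alternating sum of `F` over the orderings of four arguments. -/
def alt₄ (F : X → X → X → X → D) (x y z u : X) : D :=
  alt₃ (F x) y z u - alt₃ (F y) x z u + alt₃ (F z) x y u - alt₃ (F u) x y z

/-- The alternating sum of `F` over the orderings of five arguments. -/
def alt₅ (F : X → X → X → X → X → D) (x y z u v : X) : D :=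
  alt₄ (F x) y z u v - alt₄ (F y) x z u v + alt₄ (F z) x y u v - alt₄ (F u) x y z v
    + alt₄ (F v) x y z u

theorem sum_sign_smul_perm_three (F : X → X → X → D) (v : Fin 3 → X) :
    ∑ σ : Equiv.Perm (Fin 3), (Equiv.Perm.sign σ : ℤ) • F (v (σ 0)) (v (σ 1)) (v (σ 2)) =
      alt₃ F (v 0) (v 1) (v 2) := by
  have h1 : (1 : Fin 3) = Fin.succ 0 := rfl
  have h2 : (2 : Fin 3) = Fin.succ (Fin.succ 0) := rfl
  simp only [sum_sign_smul_perm_succ, Fin.sum_univ_succ, h1, h2,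
    Equiv.Perm.decomposeFin_symm_apply_succ, Equiv.Perm.decomposeFin_symm_apply_zero]
  simp [Equiv.swap_apply_def, Fin.ext_iff, alt₃]
  abel

theorem sum_sign_smul_perm_four (F : X → X → X → X → D) (v : Fin 4 → X) :
    ∑ σ : Equiv.Perm (Fin 4), (Equiv.Perm.sign σ : ℤ) • F (v (σ 0)) (v (σ 1)) (v (σ 2)) (v (σ 3)) =
      alt₄ F (v 0) (v 1) (v 2) (v 3) := by
  have h1 : (1 : Fin 4) = Fin.succ 0 := rfl
  have h2 : (2 : Fin 4) = Fin.succ 1 := rfl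
  have h3 : (3 : Fin 4) = Fin.succ 2 := rfl
  rw [sum_sign_smul_perm_succ]
  simp only [h1, h2, h3, Equiv.Perm.decomposeFin_symm_apply_succ,
    Equiv.Perm.decomposeFin_symm_apply_zero]
  have key (p : Fin 4) := sum_sign_smul_perm_three (F (v p)) fun i => v (Equiv.swap 0 p i.succ)
  simp only [key]
  rw [Fin.sum_univ_four]
  simp [Equiv.swap_apply_def, Fin.ext_iff, alt₄, alt₃]
  abel

theorem sum_sign_smul_perm_five (F : X → X → X → X → X → D) (v : Fin 5 → X) :
    ∑ σ : Equiv.Perm (Fin 5), (Equiv.Perm.sign σ : ℤ) •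
        F (v (σ 0)) (v (σ 1)) (v (σ 2)) (v (σ 3)) (v (σ 4)) =
      alt₅ F (v 0) (v 1) (v 2) (v 3) (v 4) := by
  have h1 : (1 : Fin 5) = Fin.succ 0 := rfl
  have h2 : (2 : Fin 5) = Fin.succ 1 := rfl
  have h3 : (3 : Fin 5) = Fin.succ 2 := rfl
  have h4 : (4 : Fin 5) = Fin.succ 3 := rfl
  rw [sum_sign_smul_perm_succ]
  simp only [h1, h2, h3, h4, Equiv.Perm.decomposeFin_symm_apply_succ,
    Equiv.Perm.decomposeFin_symm_apply_zero]
  have key (p : Fin 5) := sum_sign_smul_perm_four (F (v p)) fun i => v (Equiv.swap 0 p i.succ)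
  simp only [key]
  rw [Fin.sum_univ_five]
  simp [Equiv.swap_apply_def, Fin.ext_iff, alt₅, alt₄, alt₃]
  abel

/-- If `F` alternates in its first three arguments and changes sign when its two blocks of three
arguments are exchanged, then fixing its first argument or its last one gives the same sum. -/
theorem alt₅_eq_of_block_alternating (F : X → X → X → X → X → X → D)
    (h1 : ∀ x y z u v w, F y x z u v w = -F x y z u v w)
    (h2 : ∀ x y z u v w, F x z y u v w = -F x y z u v w)
    (h3 : ∀ x y z u v w, F u v w x y z = -F x y z u v w)
    (b c d e f g : X) :
    alt₅ (F b) c d e f g = alt₅ (fun x y z u v => F x y z u v g) b c d e f := by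
  have h4 (x y z u v w) : F x y z v u w = -F x y z u v w := by rw [h3, h1, h3 x, neg_neg]
  have h5 (x y z u v w) : F x y z u w v = -F x y z u v w := by rw [h3, h2, h3 x, neg_neg]
  obtain ⟨k, rfl, rfl, rfl, rfl, rfl, rfl⟩ : ∃ k : Fin 6 → X,
      b = k 0 ∧ c = k 1 ∧ d = k 2 ∧ e = k 3 ∧ f = k 4 ∧ g = k 5 :=
    ⟨![b, c, d, e, f, g], rfl, rfl, rfl, rfl, rfl, rfl⟩
  have r1 (i j l m n o : Fin 6) (h : i < j) := h1 (k i) (k j) (k l) (k m) (k n) (k o)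
  have r2 (i j l m n o : Fin 6) (h : j < l) := h2 (k i) (k j) (k l) (k m) (k n) (k o)
  have r3 (i j l m n o : Fin 6) (h : i < m) := h3 (k i) (k j) (k l) (k m) (k n) (k o)
  have r4 (i j l m n o : Fin 6) (h : m < n) := h4 (k i) (k j) (k l) (k m) (k n) (k o)
  have r5 (i j l m n o : Fin 6) (h : n < o) := h5 (k i) (k j) (k l) (k m) (k n) (k o)
  clear h1 h2 h3 h4 h5
  simp (discharger := decide) only [alt₅, alt₄, alt₃, r1, r2, r3, r4, r5]
  abel

end AlternatingSums

section FormalSums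

/-- The value of a formal integer combination of the words `W` under an interpretation `φ`. -/
def formalEval {W M : Type*} [AddCommGroup M] (φ : W → M) (P : List (ℤ × W)) : M :=
  (P.map fun t => t.1 • φ t.2).sum

/-- The bilinear extension of an operation on words to formal combinations. -/
def formalMul {U V W : Type*} (f : U → V → W) (P : List (ℤ × U)) (Q : List (ℤ × V)) :
    List (ℤ × W) :=
  P.flatMap fun s => Q.map fun t => (s.1 * t.1, f s.2 t.2)

/-- Scalar multiplication of a formal combination. -/
def formalSMul {W : Type*} (n : ℤ) (P : List (ℤ × W)) : List (ℤ × W) :=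
  P.map fun t => (n * t.1, t.2)

/-- Add a term to a formal combination, merging it with a term having the same word. -/
def formalInsert {W : Type*} [DecidableEq W] (c : ℤ) (w : W) : List (ℤ × W) → List (ℤ × W)
  | [] => [(c, w)]
  | t :: P => if t.2 = w then (c + t.1, w) :: P else t :: formalInsert c w P

/-- Merge the terms of a formal combination that have the same word. -/
def formalCollect {W : Type*} [DecidableEq W] : List (ℤ × W) → List (ℤ × W)
  | [] => []
  | t :: P => formalInsert t.1 t.2 (formalCollect P)

variable {U V W M M₁ M₂ : Type*} [AddCommGroup M] [AddCommGroup M₁] [AddCommGroup M₂]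

theorem formalEval_cons (φ : W → M) (t : ℤ × W) (P : List (ℤ × W)) :
    formalEval φ (t :: P) = t.1 • φ t.2 + formalEval φ P := by
  simp [formalEval]

theorem formalEval_append (φ : W → M) (P Q : List (ℤ × W)) :
    formalEval φ (P ++ Q) = formalEval φ P + formalEval φ Q := by
  simp [formalEval]

theorem formalEval_smul (φ : W → M) (n : ℤ) (P : List (ℤ × W)) :
    formalEval φ (formalSMul n P) = n • formalEval φ P := by
  induction P with
  | nil => simp [formalEval, formalSMul]
  | cons t P ih =>
    rw [formalEval_cons, smul_add, ← ih, formalSMul, List.map_cons, formalEval_cons, mul_smul]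
    rfl

theorem map_formalEval (B : M₁ →+ M) (φ : W → M₁) (P : List (ℤ × W)) :
    B (formalEval φ P) = formalEval (fun w => B (φ w)) P := by
  induction P with
  | nil => simp [formalEval]
  | cons t P ih => simp [formalEval_cons, ih]

theorem sum_smul_formalEval {ι : Type*} (s : Finset ι) (n : ι → ℤ) (φ : ι → W → M)
    (P : List (ℤ × W)) :
    ∑ i ∈ s, n i • formalEval (φ i) P = formalEval (fun w => ∑ i ∈ s, n i • φ i w) P := by
  induction P with
  | nil => simp [formalEval]
  | cons t P ih =>
    simp only [formalEval_cons, smul_add, Finset.sum_add_distrib, ih, Finset.smul_sum,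
      smul_comm t.1]

theorem formalEval_mul (B : M₁ →+ M₂ →+ M) (f : U → V → W) (φ : U → M₁) (ψ : V → M₂) (χ : W → M)
    (h : ∀ u v, χ (f u v) = B (φ u) (ψ v)) (P : List (ℤ × U)) (Q : List (ℤ × V)) :
    formalEval χ (formalMul f P Q) = B (formalEval φ P) (formalEval ψ Q) := by
  induction P with
  | nil => simp [formalEval, formalMul]
  | cons s P ih =>
    have hs : formalEval χ (Q.map fun t => (s.1 * t.1, f s.2 t.2)) =
        s.1 • B (φ s.2) (formalEval ψ Q) := by
      rw [map_formalEval, ← formalEval_smul]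
      simp [formalEval, formalSMul, h, Function.comp_def]
    rw [formalMul, List.flatMap_cons, formalEval_append, hs, formalEval_cons]
    simpa [formalMul] using ih

theorem formalEval_insert [DecidableEq W] (φ : W → M) (c : ℤ) (w : W) (P : List (ℤ × W)) :
    formalEval φ (formalInsert c w P) = c • φ w + formalEval φ P := by
  induction P with
  | nil => simp [formalInsert, formalEval]
  | cons t P ih =>
    rw [formalInsert]
    split_ifs with h
    · simp [formalEval_cons, add_smul, add_assoc, h]
    · simp only [formalEval_cons, ih]; abel

theorem formalEval_collect [DecidableEq W] (φ : W → M) (P : List (ℤ × W)) :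
    formalEval φ (formalCollect P) = formalEval φ P := by
  induction P with
  | nil => rfl
  | cons t P ih => rw [formalCollect, formalEval_insert, ih, formalEval_cons]

theorem formalEval_eq_zero_of_collect [DecidableEq W] (φ : W → M) (P : List (ℤ × W))
    (h : ∀ t ∈ formalCollect P, t.1 = 0) : formalEval φ P = 0 := by
  rw [← formalEval_collect, formalEval]
  refine List.sum_eq_zero fun x hx => ?_
  obtain ⟨t, ht, rfl⟩ := List.mem_map.1 hx
  rw [h t ht, zero_smul]

/-- The combination `xyz - yxz + yzx`, built from products of `P` with factors placed on its
right or left. -/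
def formalHalf {W : Type*} (mulRight : List (ℤ × W) → List (ℤ × V) → List (ℤ × W))
    (mulLeft : List (ℤ × V) → List (ℤ × W) → List (ℤ × W))
    (P : List (ℤ × W)) (Q R : List (ℤ × V)) : List (ℤ × W) :=
  mulRight (mulRight P Q) R ++ formalSMul (-1) (mulRight (mulLeft Q P) R) ++
    mulLeft Q (mulLeft R P)

/-- Formal combinations of words in the letters `some 0, …, some 4` and `none`. -/
abbrev OuterSum : Type := List (ℤ × List (Option (Fin 5)))

/-- Formal combinations of words with a distinguished central letter, recorded as the pair of
the words to the left and to the right of the centre. -/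
abbrev CentralSum : Type := List (ℤ × List (Option (Fin 5)) × List (Option (Fin 5)))

/-- The combination `xyz - yxz + yzx` of three combinations of words without a centre. -/
def OuterSum.half : OuterSum → OuterSum → OuterSum → OuterSum :=
  formalHalf (formalMul (· ++ ·)) (formalMul (· ++ ·))

/-- The combination `xyz - yxz + yzx` where `x` contains the central letter. -/
def CentralSum.half : CentralSum → OuterSum → OuterSum → CentralSum :=
  formalHalf (formalMul fun w q => (w.1, w.2 ++ q)) (formalMul fun p w => (p ++ w.1, w.2))

/-- The formal counterpart of the bracket `[x,y,z]`, where `x` has no centre. -/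
def OuterSum.pats (P Q R : OuterSum) : OuterSum :=
  half P Q R ++ formalSMul (-1) (half P R Q)

/-- The formal counterpart of the bracket `[x,y,z]`, where `x` contains the central letter. -/
def CentralSum.pats (P : CentralSum) (Q R : OuterSum) : CentralSum :=
  half P Q R ++ formalSMul (-1) (half P R Q)

end FormalSums

namespace Dialgebra

variable {k D : Type*} [CommRing k] [AddCommGroup D] [Module k D] (A : Dialgebra k D)

/-- Left multiplication `x ⊢ ·`. -/
def opL (x : D) : Module.End k D := A.r x

/-- Right multiplication `· ⊣ x`. -/
def opR (x : D) : Module.End k D := A.l.flip x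

theorem opL_l (x y : D) : A.opL (A.l x y) = A.opL x * A.opL y := by
  ext z; simp [opL, A.bar_right, A.r_assoc]

theorem opL_r (x y : D) : A.opL (A.r x y) = A.opL x * A.opL y := by
  ext z; simp [opL, A.r_assoc]

theorem opR_l (x y : D) : A.opR (A.l x y) = A.opR y * A.opR x := by
  ext z; simp [opR, A.l_assoc]

theorem opR_r (x y : D) : A.opR (A.r x y) = A.opR y * A.opR x := by
  ext z; simp [opR, A.l_assoc, A.bar_left]

theorem commute_opR_opL (x y : D) : Commute (A.opR x) (A.opL y) := by
  ext z; simp [opL, opR, A.inner_assoc]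

/-- Left action of a word. -/
def wordL {I : Type*} (v : I → D) (p : List I) : Module.End k D :=
  (p.map fun i => A.opL (v i)).prod

/-- Right action of a word. -/
def wordR {I : Type*} (v : I → D) (q : List I) : Module.End k D :=
  (q.reverse.map fun i => A.opR (v i)).prod

/-- The operator multiplying its argument by `w.1` on the left and by `w.2` on the right. -/
def wordLR {I : Type*} (v : I → D) (w : List I × List I) : Module.End k D :=
  A.wordL v w.1 * A.wordR v w.2

theorem wordL_append {I : Type*} (v : I → D) (p q : List I) :
    A.wordL v (p ++ q) = A.wordL v p * A.wordL v q := by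
  simp [wordL]

theorem wordR_append {I : Type*} (v : I → D) (p q : List I) :
    A.wordR v (p ++ q) = A.wordR v q * A.wordR v p := by
  simp [wordR]

theorem commute_wordR_wordL {I : Type*} (v : I → D) (p q : List I) :
    Commute (A.wordR v p) (A.wordL v q) := by
  refine Commute.list_prod_left _ _ fun x hx => Commute.list_prod_right _ _ fun y hy => ?_
  obtain ⟨i, -, rfl⟩ := List.mem_map.1 hx
  obtain ⟨j, -, rfl⟩ := List.mem_map.1 hy
  exact A.commute_opR_opL _ _

theorem wordLR_append_right {I : Type*} (v : I → D) (w : List I × List I) (q : List I) :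
    A.wordLR v (w.1, w.2 ++ q) = A.wordR v q * A.wordLR v w := by
  rw [wordLR, wordLR, wordR_append, ← mul_assoc, ← mul_assoc, (A.commute_wordR_wordL v q w.1).eq]

theorem wordLR_append_left {I : Type*} (v : I → D) (p : List I) (w : List I × List I) :
    A.wordLR v (p ++ w.1, w.2) = A.wordL v p * A.wordLR v w := by
  rw [wordLR, wordLR, wordL_append, mul_assoc]

/-- Half of the terms of the bracket: `x⊣y⊣z - (y⊢x)⊣z + y⊢(z⊢x)`. -/
def half (x y z : D) : D :=
  A.l (A.l x y) z - A.l (A.r y x) z + A.r y (A.r z x)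

theorem pats_eq_half_sub (x y z : D) : A.pats x y z = A.half x y z - A.half x z y := by
  rw [pats, half, half]; abel

theorem half_sub_left (x x' y z : D) : A.half (x - x') y z = A.half x y z - A.half x' y z := by
  simp only [half, map_sub, LinearMap.sub_apply]; abel

theorem pats_sub_left (x x' y z : D) : A.pats (x - x') y z = A.pats x y z - A.pats x' y z := by
  simp only [pats_eq_half_sub, half_sub_left]; abel

theorem half_sub_middle (x y y' z : D) :
    A.half x (y - y') z = A.half x y z - A.half x y' z := by
  simp only [half, map_sub, LinearMap.sub_apply]; abel

theorem half_sub_right (x y z z' : D) :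
    A.half x y (z - z') = A.half x y z - A.half x y z' := by
  simp only [half, map_sub, LinearMap.sub_apply]; abel

theorem pats_sub_middle (x y y' z : D) :
    A.pats x (y - y') z = A.pats x y z - A.pats x y' z := by
  simp only [pats_eq_half_sub, half_sub_middle, half_sub_right]; abel

theorem pats_sub_right (x y z z' : D) :
    A.pats x y (z - z') = A.pats x y z - A.pats x y z' := by
  simp only [pats_eq_half_sub, half_sub_middle, half_sub_right]; abel

theorem pats_swap_right (x y z : D) : A.pats x z y = -A.pats x y z := by
  rw [pats_eq_half_sub, pats_eq_half_sub, neg_sub]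

theorem opL_half (x y z : D) : A.opL (A.half x y z) =
    A.opL x * A.opL y * A.opL z - A.opL y * A.opL x * A.opL z + A.opL y * A.opL z * A.opL x := by
  have h₁ (x y : D) : A.opL (x - y) = A.opL x - A.opL y := map_sub A.r x y
  have h₂ (x y : D) : A.opL (x + y) = A.opL x + A.opL y := map_add A.r x y
  simp only [half, h₁, h₂, opL_l, opL_r, mul_assoc]

theorem opR_half (x y z : D) : A.opR (A.half x y z) =
    A.opR z * A.opR y * A.opR x - A.opR z * A.opR x * A.opR y + A.opR x * A.opR z * A.opR y := by
  have h₁ (x y : D) : A.opR (x - y) = A.opR x - A.opR y := map_sub A.l.flip x y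
  have h₂ (x y : D) : A.opR (x + y) = A.opR x + A.opR y := map_add A.l.flip x y
  simp only [half, h₁, h₂, opR_l, opR_r, mul_assoc]

theorem pats_pats_swap_left (a x y z u : D) :
    A.pats a (A.pats y x z) u = -A.pats a (A.pats x y z) u := by
  have hL : A.opL (A.pats y x z) = -A.opL (A.pats x y z) := by
    have h (x y : D) : A.opL (x - y) = A.opL x - A.opL y := map_sub A.r x y
    simp only [pats_eq_half_sub, h, opL_half]; abel
  have hR : A.opR (A.pats y x z) = -A.opR (A.pats x y z) := by
    have h (x y : D) : A.opR (x - y) = A.opR x - A.opR y := map_sub A.l.flip x y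
    simp only [pats_eq_half_sub, h, opR_half]; abel
  have key (y z : D) : A.pats a y z = (A.opR z * A.opR y - A.opR y * A.opR z - A.opR z * A.opL y +
      A.opR y * A.opL z + A.opL y * A.opL z - A.opL z * A.opL y) a := rfl
  rw [key, key, hL, hR, ← LinearMap.neg_apply]
  congr 1
  noncomm_ring

theorem pats_pats_swap_right (a x y z u : D) :
    A.pats a (A.pats x z y) u = -A.pats a (A.pats x y z) u := by
  rw [A.pats_swap_right x y z, ← zero_sub (A.pats x y z), pats_sub_middle]
  simp [pats]

theorem pats_pats_rotate (a x y z u : D) :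
    A.pats a (A.pats x y z) u = A.pats a (A.pats z x y) u := by
  rw [A.pats_pats_swap_left a x z y u, A.pats_pats_swap_right a x y z u, neg_neg]

variable (v : Option (Fin 5) → D) (a : D)

/-- `x` multiplies other elements as the combination `P` does. -/
def OuterRep (P : OuterSum) (x : D) : Prop :=
  A.opL x = formalEval (A.wordL v) P ∧ A.opR x = formalEval (A.wordR v) P

/-- `x` is the value of the combination `P` with the central letter `a`. -/
def CentralRep (P : CentralSum) (x : D) : Prop :=
  x = formalEval (A.wordLR v) P a

variable {A v a}

theorem OuterRep.letter (i : Option (Fin 5)) : A.OuterRep v [(1, [i])] (v i) := by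
  simp [OuterRep, formalEval, wordL, wordR]

theorem CentralRep.centre : A.CentralRep v a [(1, ([], []))] a := by
  simp [CentralRep, formalEval, wordL, wordR, wordLR]

theorem formalEval_wordL_mul (P Q : OuterSum) :
    formalEval (A.wordL v) (formalMul (· ++ ·) P Q) =
      formalEval (A.wordL v) P * formalEval (A.wordL v) Q :=
  formalEval_mul (AddMonoidHom.mul (R := Module.End k D)) _ _ _ _
    (A.wordL_append v) P Q

theorem formalEval_wordR_mul (P Q : OuterSum) :
    formalEval (A.wordR v) (formalMul (· ++ ·) P Q) =
      formalEval (A.wordR v) Q * formalEval (A.wordR v) P :=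
  formalEval_mul (AddMonoidHom.mul (R := Module.End k D)).flip _ _ _ _
    (A.wordR_append v) P Q

theorem formalEval_wordLR_mul_right (P : CentralSum) (Q : OuterSum) :
    formalEval (A.wordLR v) (formalMul (fun w q => (w.1, w.2 ++ q)) P Q) =
      formalEval (A.wordR v) Q * formalEval (A.wordLR v) P :=
  formalEval_mul (AddMonoidHom.mul (R := Module.End k D)).flip _ _ _ _
    (A.wordLR_append_right v) P Q

theorem formalEval_wordLR_mul_left (P : OuterSum) (Q : CentralSum) :
    formalEval (A.wordLR v) (formalMul (fun p w => (p ++ w.1, w.2)) P Q) =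
      formalEval (A.wordL v) P * formalEval (A.wordLR v) Q :=
  formalEval_mul (AddMonoidHom.mul (R := Module.End k D)) _ _ _ _
    (A.wordLR_append_left v) P Q

theorem OuterRep.half {P Q R : OuterSum} {x y z : D} (hx : A.OuterRep v P x)
    (hy : A.OuterRep v Q y) (hz : A.OuterRep v R z) :
    A.OuterRep v (OuterSum.half P Q R) (A.half x y z) := by
  constructor
  · simp only [opL_half, OuterSum.half, formalHalf, formalEval_append, formalEval_smul,
      formalEval_wordL_mul, hx.1, hy.1, hz.1, mul_assoc]
    abel
  · simp only [opR_half, OuterSum.half, formalHalf, formalEval_append, formalEval_smul,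
      formalEval_wordR_mul, hx.2, hy.2, hz.2, mul_assoc]
    abel

theorem OuterRep.pats {P Q R : OuterSum} {x y z : D} (hx : A.OuterRep v P x)
    (hy : A.OuterRep v Q y) (hz : A.OuterRep v R z) :
    A.OuterRep v (OuterSum.pats P Q R) (A.pats x y z) := by
  have hL (x y : D) : A.opL (x - y) = A.opL x - A.opL y := map_sub A.r x y
  have hR (x y : D) : A.opR (x - y) = A.opR x - A.opR y := map_sub A.l.flip x y
  have h₁ := hx.half hy hz
  have h₂ := hx.half hz hy
  constructor
  · rw [pats_eq_half_sub, hL, h₁.1, h₂.1, OuterSum.pats, formalEval_append, formalEval_smul,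
      neg_one_smul, sub_eq_add_neg]
  · rw [pats_eq_half_sub, hR, h₁.2, h₂.2, OuterSum.pats, formalEval_append, formalEval_smul,
      neg_one_smul, sub_eq_add_neg]

theorem CentralRep.half {P : CentralSum} {Q R : OuterSum} {x y z : D}
    (hx : A.CentralRep v a P x) (hy : A.OuterRep v Q y) (hz : A.OuterRep v R z) :
    A.CentralRep v a (CentralSum.half P Q R) (A.half x y z) := by
  have h₁ (x y : D) : A.l x y = A.opR y x := rfl
  have h₂ (x y : D) : A.r x y = A.opL x y := rfl
  simp only [CentralRep, Dialgebra.half, h₁, h₂, CentralSum.half, formalHalf, formalEval_append,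
    formalEval_smul, formalEval_wordLR_mul_right, formalEval_wordLR_mul_left, hy.1, hy.2, hz.1,
    hz.2, LinearMap.add_apply, LinearMap.smul_apply, Module.End.mul_apply]
  rw [show x = formalEval (A.wordLR v) P a from hx]
  abel

theorem CentralRep.pats {P : CentralSum} {Q R : OuterSum} {x y z : D}
    (hx : A.CentralRep v a P x) (hy : A.OuterRep v Q y) (hz : A.OuterRep v R z) :
    A.CentralRep v a (CentralSum.pats P Q R) (A.pats x y z) := by
  rw [CentralRep, pats_eq_half_sub, CentralSum.pats, formalEval_append, formalEval_smul,
    LinearMap.add_apply, LinearMap.smul_apply, ← hx.half hy hz, ← hx.half hz hy, neg_one_smul,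
    sub_eq_add_neg]

theorem CentralRep.append {P Q : CentralSum} {x y : D} (hx : A.CentralRep v a P x)
    (hy : A.CentralRep v a Q y) : A.CentralRep v a (P ++ Q) (x + y) := by
  rw [CentralRep, formalEval_append, LinearMap.add_apply, ← hx, ← hy]

theorem CentralRep.smul {P : CentralSum} {x : D} (n : ℤ) (hx : A.CentralRep v a P x) :
    A.CentralRep v a (formalSMul n P) (n • x) := by
  rw [CentralRep, formalEval_smul, LinearMap.smul_apply, ← hx]

end Dialgebra

section Alternation

/-- Rename the letters `some i`. -/
def relabel (h : Fin 5 → Fin 5) (w : List (Option (Fin 5)) × List (Option (Fin 5))) :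
    List (Option (Fin 5)) × List (Option (Fin 5)) :=
  (w.1.map (Option.map h), w.2.map (Option.map h))

/-- The sign of `h` when it is a permutation, and zero when it is not injective. -/
def signOfMap (h : Fin 5 → Fin 5) : ℤ :=
  ∏ i, ∏ j ∈ Finset.Ioi i, if h i < h j then 1 else if h j < h i then -1 else 0

theorem signOfMap_perm (π : Equiv.Perm (Fin 5)) : signOfMap π = Equiv.Perm.sign π := by
  rw [π.sign_eq_prod_prod_Ioi, signOfMap]
  push_cast
  refine Finset.prod_congr rfl fun i _ => Finset.prod_congr rfl fun j hj => ?_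
  have : π i ≠ π j := π.injective.ne (Finset.mem_Ioi.1 hj).ne
  split_ifs <;> first | rfl | omega

theorem injective_of_signOfMap_ne_zero {h : Fin 5 → Fin 5} (hh : signOfMap h ≠ 0) :
    Function.Injective h := by
  intro i j hij
  by_contra hne
  wlog hlt : i < j generalizing i j
  · exact this hij.symm (Ne.symm hne) (lt_of_le_of_ne (not_lt.1 hlt) (Ne.symm hne))
  refine hh (Finset.prod_eq_zero (Finset.mem_univ i) (Finset.prod_eq_zero (i := j) ?_ ?_))
  · simpa using hlt
  · simp [hij]

/-- The position of `some i` among the letters `some j` of a word. -/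
def letterRank (w : List (Option (Fin 5)) × List (Option (Fin 5))) (i : Fin 5) : Fin 5 :=
  Fin.ofNat 5 ((w.1 ++ w.2).reduceOption.idxOf i)

/-- Rename the letters of a word so that they occur in increasing order, up to sign. -/
def sortLetters (t : ℤ × List (Option (Fin 5)) × List (Option (Fin 5))) :
    ℤ × List (Option (Fin 5)) × List (Option (Fin 5)) :=
  let s := signOfMap (letterRank t.2)
  if s = 0 then t else (t.1 * s, relabel (letterRank t.2) t.2)

/-- Sorting the letters of the words does not change the alternating sum over the relabellings of
the letters `some i`. -/
theorem formalEval_sortLetters {M : Type*} [AddCommGroup M]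
    (φ : (Fin 5 → Fin 5) → List (Option (Fin 5)) × List (Option (Fin 5)) → M)
    (hφ : ∀ h h' w, φ h (relabel h' w) = φ (h ∘ h') w) (P : CentralSum) :
    formalEval (fun w => ∑ σ : Equiv.Perm (Fin 5), (Equiv.Perm.sign σ : ℤ) • φ σ w)
        (P.map sortLetters) =
      formalEval (fun w => ∑ σ : Equiv.Perm (Fin 5), (Equiv.Perm.sign σ : ℤ) • φ σ w) P := by
  induction P with
  | nil => rfl
  | cons t P ih =>
    rw [List.map_cons, formalEval_cons, formalEval_cons, ih]
    congr 1
    rw [sortLetters]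
    split_ifs with hs
    · rfl
    have hbij := Finite.injective_iff_bijective.1 (injective_of_signOfMap_ne_zero hs)
    obtain ⟨π, hπ⟩ : ∃ π : Equiv.Perm (Fin 5), ⇑π = letterRank t.2 :=
      ⟨Equiv.ofBijective _ hbij, rfl⟩
    rw [← hπ, signOfMap_perm, mul_smul, Finset.smul_sum,
      ← Equiv.sum_comp (Equiv.mulRight π) fun σ => (Equiv.Perm.sign σ : ℤ) • φ σ t.2]
    congr 1
    refine Finset.sum_congr rfl fun σ _ => ?_
    rw [hφ, smul_smul, Equiv.coe_mulRight, Equiv.Perm.sign_mul, Equiv.Perm.coe_mul, mul_comm]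
    push_cast
    rfl

/-- An alternating sum of differences `G σ - G (σ ∘ (i j))` is twice that of `G`. -/
theorem sum_sign_smul_of_eq_sub_swap {M : Type*} [AddCommGroup M] {n : ℕ} {i j : Fin n}
    (hij : i ≠ j) {E G : Equiv.Perm (Fin n) → M} (h : ∀ σ, E σ = G σ - G (σ * Equiv.swap i j)) :
    ∑ σ, (Equiv.Perm.sign σ : ℤ) • E σ = (2 : ℤ) • ∑ σ, (Equiv.Perm.sign σ : ℤ) • G σ := by
  have hG : ∑ σ, (Equiv.Perm.sign σ : ℤ) • G (σ * Equiv.swap i j) =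
      -∑ σ, (Equiv.Perm.sign σ : ℤ) • G σ := by
    rw [← Equiv.sum_comp (Equiv.mulRight (Equiv.swap i j)) fun σ => (Equiv.Perm.sign σ : ℤ) • G σ,
      ← Finset.sum_neg_distrib]
    simp [Equiv.Perm.sign_swap hij]
  simp only [h, smul_sub, Finset.sum_sub_distrib, hG]
  abel

end Alternation

section Certificate

/-- The letter `some i` as a formal combination. -/
def letter (i : Fin 5) : OuterSum := [(1, [some i])]

/-- The letter `none` as a formal combination. -/
def lastLetter : OuterSum := [(1, [none])]

/-- The central letter as a formal combination. -/
def centre : CentralSum := [(1, ([], []))]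

open CentralSum in
/-- The formal counterpart of the identity, with brackets alternating in two variables
replaced by their halves. -/
def patsCertificate : CentralSum :=
  formalSMul 12 (half (pats (half centre (letter 0) (letter 1)) (letter 2) lastLetter)
    (letter 3) (letter 4)) ++
  formalSMul (-4) (pats (pats centre (OuterSum.half (letter 0) (letter 1) (letter 2)) (letter 3))
    (letter 4) lastLetter) ++
  formalSMul 12 (half (pats centre (OuterSum.half lastLetter (letter 0) (letter 1)) (letter 2))
    (letter 3) (letter 4)) ++
  formalSMul 4 (pats (half centre (letter 0) (letter 1))
    (OuterSum.half (letter 2) (letter 3) (letter 4)) lastLetter) ++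
  formalSMul (-4) (pats centre (OuterSum.pats (OuterSum.half (letter 0) (letter 1) (letter 2))
    (letter 3) lastLetter) (letter 4)) ++
  formalSMul (-4) (pats centre (OuterSum.half (letter 0) (letter 1) (letter 2))
    (OuterSum.half lastLetter (letter 3) (letter 4)))

theorem patsCertificate_cancels :
    ∀ t ∈ formalCollect (patsCertificate.map sortLetters), t.1 = 0 := by
  decide +kernel

end Certificate

namespace Dialgebra

variable {k D : Type*} [CommRing k] [AddCommGroup D] [Module k D] (A : Dialgebra k D)

theorem wordLR_relabel (v : Option (Fin 5) → D) (h : Fin 5 → Fin 5)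
    (w : List (Option (Fin 5)) × List (Option (Fin 5))) :
    A.wordLR v (relabel h w) = A.wordLR (v ∘ Option.map h) w := by
  simp [wordLR, wordL, wordR, relabel, ← List.map_reverse, Function.comp_def]

/-- Elements represented by a combination that cancels after sorting the letters have vanishing
alternating sum. -/
theorem sum_sign_smul_eq_zero_of_centralRep (x : Fin 5 → D) (g a : D) (P : CentralSum)
    (hP : ∀ t ∈ formalCollect (P.map sortLetters), t.1 = 0) (E : Equiv.Perm (Fin 5) → D)
    (hE : ∀ σ, A.CentralRep (fun o => o.elim g fun i => x (σ i)) a P (E σ)) :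
    ∑ σ, (Equiv.Perm.sign σ : ℤ) • E σ = 0 := by
  let φ (h : Fin 5 → Fin 5) (w : List (Option (Fin 5)) × List (Option (Fin 5))) : D :=
    A.wordLR (fun o => o.elim g fun i => x (h i)) w a
  have hφ (h h' : Fin 5 → Fin 5) (w) : φ h (relabel h' w) = φ (h ∘ h') w := by
    simp only [φ, wordLR_relabel]
    congr 2
    funext o
    cases o <;> rfl
  have hE' (σ : Equiv.Perm (Fin 5)) : E σ = formalEval (φ σ) P := by
    rw [hE σ]
    exact map_formalEval (LinearMap.applyₗ a : Module.End k D →ₗ[k] D).toAddMonoidHom _ P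
  have hsum : ∑ σ : Equiv.Perm (Fin 5), (Equiv.Perm.sign σ : ℤ) • E σ =
      formalEval (fun w => ∑ σ : Equiv.Perm (Fin 5), (Equiv.Perm.sign σ : ℤ) • φ σ w) P := by
    simp only [hE', sum_smul_formalEval]
  rw [hsum, ← formalEval_sortLetters φ hφ]
  exact formalEval_eq_zero_of_collect _ _ hP

section Halving

variable (a g : D) (x : Fin 5 → D)

theorem sum_pats_pats_pats_left : ∑ σ : Equiv.Perm (Fin 5), (Equiv.Perm.sign σ : ℤ) •
      A.pats (A.pats (A.pats a (x (σ 0)) (x (σ 1))) (x (σ 2)) g) (x (σ 3)) (x (σ 4)) =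
    (4 : ℤ) • ∑ σ : Equiv.Perm (Fin 5), (Equiv.Perm.sign σ : ℤ) •
      A.half (A.pats (A.half a (x (σ 0)) (x (σ 1))) (x (σ 2)) g) (x (σ 3)) (x (σ 4)) := by
  rw [sum_sign_smul_of_eq_sub_swap (i := 0) (j := 1) (by decide)
      (G := fun σ => A.pats (A.pats (A.half a (x (σ 0)) (x (σ 1))) (x (σ 2)) g)
        (x (σ 3)) (x (σ 4))),
    sum_sign_smul_of_eq_sub_swap (i := 3) (j := 4) (by decide)
      (G := fun σ => A.half (A.pats (A.half a (x (σ 0)) (x (σ 1))) (x (σ 2)) g)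
        (x (σ 3)) (x (σ 4))), smul_smul]
  · rfl
  · intro σ
    simp [A.pats_eq_half_sub _ (x (σ 3)), Equiv.swap_apply_def]
  · intro σ
    simp [A.pats_eq_half_sub a, pats_sub_left, Equiv.swap_apply_def]

theorem sum_pats_pats_middle_last : ∑ σ : Equiv.Perm (Fin 5), (Equiv.Perm.sign σ : ℤ) •
      A.pats (A.pats a (A.pats (x (σ 0)) (x (σ 1)) (x (σ 2))) (x (σ 3))) (x (σ 4)) g =
    (2 : ℤ) • ∑ σ : Equiv.Perm (Fin 5), (Equiv.Perm.sign σ : ℤ) •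
      A.pats (A.pats a (A.half (x (σ 0)) (x (σ 1)) (x (σ 2))) (x (σ 3))) (x (σ 4)) g := by
  refine sum_sign_smul_of_eq_sub_swap (i := 1) (j := 2) (by decide) fun σ => ?_
  simp [A.pats_eq_half_sub (x (σ 0)), pats_sub_middle, pats_sub_left, Equiv.swap_apply_def]

theorem sum_pats_pats_middle : ∑ σ : Equiv.Perm (Fin 5), (Equiv.Perm.sign σ : ℤ) •
      A.pats (A.pats a (A.pats (x (σ 0)) (x (σ 1)) g) (x (σ 2))) (x (σ 3)) (x (σ 4)) =
    (4 : ℤ) • ∑ σ : Equiv.Perm (Fin 5), (Equiv.Perm.sign σ : ℤ) •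
      A.half (A.pats a (A.half g (x (σ 0)) (x (σ 1))) (x (σ 2))) (x (σ 3)) (x (σ 4)) := by
  simp only [A.pats_pats_rotate a _ _ g]
  rw [sum_sign_smul_of_eq_sub_swap (i := 0) (j := 1) (by decide)
      (G := fun σ => A.pats (A.pats a (A.half g (x (σ 0)) (x (σ 1))) (x (σ 2)))
        (x (σ 3)) (x (σ 4))),
    sum_sign_smul_of_eq_sub_swap (i := 3) (j := 4) (by decide)
      (G := fun σ => A.half (A.pats a (A.half g (x (σ 0)) (x (σ 1))) (x (σ 2)))
        (x (σ 3)) (x (σ 4))), smul_smul]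
  · rfl
  · intro σ
    simp [A.pats_eq_half_sub _ (x (σ 3)), Equiv.swap_apply_def]
  · intro σ
    simp [A.pats_eq_half_sub g, pats_sub_middle, pats_sub_left, Equiv.swap_apply_def]

theorem sum_pats_pats_pats_last : ∑ σ : Equiv.Perm (Fin 5), (Equiv.Perm.sign σ : ℤ) •
      A.pats (A.pats a (x (σ 0)) (x (σ 1))) (A.pats (x (σ 2)) (x (σ 3)) (x (σ 4))) g =
    (4 : ℤ) • ∑ σ : Equiv.Perm (Fin 5), (Equiv.Perm.sign σ : ℤ) •
      A.pats (A.half a (x (σ 0)) (x (σ 1))) (A.half (x (σ 2)) (x (σ 3)) (x (σ 4))) g := by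
  rw [sum_sign_smul_of_eq_sub_swap (i := 0) (j := 1) (by decide)
      (G := fun σ => A.pats (A.half a (x (σ 0)) (x (σ 1)))
        (A.pats (x (σ 2)) (x (σ 3)) (x (σ 4))) g),
    sum_sign_smul_of_eq_sub_swap (i := 3) (j := 4) (by decide)
      (G := fun σ => A.pats (A.half a (x (σ 0)) (x (σ 1)))
        (A.half (x (σ 2)) (x (σ 3)) (x (σ 4))) g), smul_smul]
  · rfl
  · intro σ
    simp [A.pats_eq_half_sub (x (σ 2)), pats_sub_middle, Equiv.swap_apply_def]
  · intro σ
    simp [A.pats_eq_half_sub a, pats_sub_left, Equiv.swap_apply_def]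

theorem sum_pats_pats_pats_middle : ∑ σ : Equiv.Perm (Fin 5), (Equiv.Perm.sign σ : ℤ) •
      A.pats a (A.pats (A.pats (x (σ 0)) (x (σ 1)) (x (σ 2))) (x (σ 3)) g) (x (σ 4)) =
    (2 : ℤ) • ∑ σ : Equiv.Perm (Fin 5), (Equiv.Perm.sign σ : ℤ) •
      A.pats a (A.pats (A.half (x (σ 0)) (x (σ 1)) (x (σ 2))) (x (σ 3)) g) (x (σ 4)) := by
  refine sum_sign_smul_of_eq_sub_swap (i := 1) (j := 2) (by decide) fun σ => ?_
  simp [A.pats_eq_half_sub (x (σ 0)), pats_sub_middle, pats_sub_left, Equiv.swap_apply_def]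

theorem sum_pats_pats_pats : ∑ σ : Equiv.Perm (Fin 5), (Equiv.Perm.sign σ : ℤ) •
      A.pats a (A.pats (x (σ 0)) (x (σ 1)) (x (σ 2))) (A.pats (x (σ 3)) (x (σ 4)) g) =
    (4 : ℤ) • ∑ σ : Equiv.Perm (Fin 5), (Equiv.Perm.sign σ : ℤ) •
      A.pats a (A.half (x (σ 0)) (x (σ 1)) (x (σ 2))) (A.half g (x (σ 3)) (x (σ 4))) := by
  have hrot (y z u : D) : A.pats a u (A.pats y z g) = A.pats a u (A.pats g y z) := by
    rw [A.pats_swap_right a (A.pats y z g) u, A.pats_pats_rotate, ← pats_swap_right]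
  simp only [hrot]
  rw [sum_sign_smul_of_eq_sub_swap (i := 1) (j := 2) (by decide)
      (G := fun σ => A.pats a (A.half (x (σ 0)) (x (σ 1)) (x (σ 2)))
        (A.pats g (x (σ 3)) (x (σ 4)))),
    sum_sign_smul_of_eq_sub_swap (i := 3) (j := 4) (by decide)
      (G := fun σ => A.pats a (A.half (x (σ 0)) (x (σ 1)) (x (σ 2)))
        (A.half g (x (σ 3)) (x (σ 4)))), smul_smul]
  · rfl
  · intro σ
    simp [A.pats_eq_half_sub g, pats_sub_right, Equiv.swap_apply_def]
  · intro σ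
    simp [A.pats_eq_half_sub (x (σ 0)), pats_sub_middle, Equiv.swap_apply_def]

/-- In `∑ ε(σ) [a,[·,·,·],[·,·,·]]` the fixed first letter can be traded for a fixed last one. -/
theorem sum_pats_pats_pats_first_eq_last (b c d e f : D) :
    ∑ σ : Equiv.Perm (Fin 5), (Equiv.Perm.sign σ : ℤ) •
      A.pats a (A.pats b (![c,d,e,f,g] (σ 0)) (![c,d,e,f,g] (σ 1)))
        (A.pats (![c,d,e,f,g] (σ 2)) (![c,d,e,f,g] (σ 3)) (![c,d,e,f,g] (σ 4))) =
    ∑ σ : Equiv.Perm (Fin 5), (Equiv.Perm.sign σ : ℤ) •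
      A.pats a (A.pats (![b,c,d,e,f] (σ 0)) (![b,c,d,e,f] (σ 1)) (![b,c,d,e,f] (σ 2)))
        (A.pats (![b,c,d,e,f] (σ 3)) (![b,c,d,e,f] (σ 4)) g) := by
  rw [sum_sign_smul_perm_five (fun y z u v w => A.pats a (A.pats b y z) (A.pats u v w)),
    sum_sign_smul_perm_five (fun y z u v w => A.pats a (A.pats y z u) (A.pats v w g))]
  exact alt₅_eq_of_block_alternating
    (fun y z u v w t => A.pats a (A.pats y z u) (A.pats v w t))
    (fun _ _ _ _ _ _ => A.pats_pats_swap_left _ _ _ _ _)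
    (fun _ _ _ _ _ _ => A.pats_pats_swap_right _ _ _ _ _)
    (fun _ _ _ _ _ _ => A.pats_swap_right _ _ _) b c d e f g

/-- The identity with every bracket that alternates in two permuted variables replaced by its
half. -/
theorem sum_sign_smul_half_identity : ∑ σ : Equiv.Perm (Fin 5), (Equiv.Perm.sign σ : ℤ) •
    ((12 : ℤ) • A.half (A.pats (A.half a (x (σ 0)) (x (σ 1))) (x (σ 2)) g) (x (σ 3)) (x (σ 4)) +
      (-4 : ℤ) • A.pats (A.pats a (A.half (x (σ 0)) (x (σ 1)) (x (σ 2))) (x (σ 3))) (x (σ 4)) g +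
      (12 : ℤ) • A.half (A.pats a (A.half g (x (σ 0)) (x (σ 1))) (x (σ 2))) (x (σ 3)) (x (σ 4)) +
      (4 : ℤ) • A.pats (A.half a (x (σ 0)) (x (σ 1))) (A.half (x (σ 2)) (x (σ 3)) (x (σ 4))) g +
      (-4 : ℤ) • A.pats a (A.pats (A.half (x (σ 0)) (x (σ 1)) (x (σ 2))) (x (σ 3)) g) (x (σ 4)) +
      (-4 : ℤ) • A.pats a (A.half (x (σ 0)) (x (σ 1)) (x (σ 2)))
        (A.half g (x (σ 3)) (x (σ 4)))) = 0 := by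
  refine A.sum_sign_smul_eq_zero_of_centralRep x g a patsCertificate patsCertificate_cancels _
    fun σ => ?_
  have hx (i : Fin 5) : A.OuterRep (fun o => o.elim g fun i => x (σ i)) (letter i) (x (σ i)) :=
    OuterRep.letter (some i)
  have hg : A.OuterRep (fun o => o.elim g fun i => x (σ i)) lastLetter g := OuterRep.letter none
  have ha : A.CentralRep (fun o => o.elim g fun i => x (σ i)) a centre a := CentralRep.centre
  have h₀ := (hx 0).half (hx 1) (hx 2)
  exact ((((((((ha.half (hx 0) (hx 1)).pats (hx 2) hg).half (hx 3) (hx 4)).smul 12).append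
    (((ha.pats h₀ (hx 3)).pats (hx 4) hg).smul (-4))).append
    (((ha.pats (hg.half (hx 0) (hx 1)) (hx 2)).half (hx 3) (hx 4)).smul 12)).append
    (((ha.half (hx 0) (hx 1)).pats ((hx 2).half (hx 3) (hx 4)) hg).smul 4)).append
    ((ha.pats (h₀.pats (hx 3) hg) (hx 4)).smul (-4))).append
    ((ha.pats h₀ (hg.half (hx 3) (hx 4))).smul (-4))

end Halving

end Dialgebra

/-- the PATS satisfies the degree-7 identity `12·S = 0`:
`3Σ₁ − 2Σ₂ + 3Σ₃ + Σ₄ − 2Σ₅ − Σ₆ = 0`, where `σ` permutes `(b,c,d,e,f)` in `Σ₁,…,Σ₅`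
and `(c,d,e,f,g)` in `Σ₆`. -/
theorem pats_identity_S
    (k D : Type*) [CommRing k] [AddCommGroup D] [Module k D]
    (A : Dialgebra k D) (a b c d e f g : D) :
    (3 : ℤ) • (∑ σ : Equiv.Perm (Fin 5), (Equiv.Perm.sign σ : ℤ) •
        A.pats (A.pats (A.pats a (![b,c,d,e,f] (σ 0)) (![b,c,d,e,f] (σ 1)))
          (![b,c,d,e,f] (σ 2)) g) (![b,c,d,e,f] (σ 3)) (![b,c,d,e,f] (σ 4)))
    - (2 : ℤ) • (∑ σ : Equiv.Perm (Fin 5), (Equiv.Perm.sign σ : ℤ) •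
        A.pats (A.pats a (A.pats (![b,c,d,e,f] (σ 0)) (![b,c,d,e,f] (σ 1))
          (![b,c,d,e,f] (σ 2))) (![b,c,d,e,f] (σ 3))) (![b,c,d,e,f] (σ 4)) g)
    + (3 : ℤ) • (∑ σ : Equiv.Perm (Fin 5), (Equiv.Perm.sign σ : ℤ) •
        A.pats (A.pats a (A.pats (![b,c,d,e,f] (σ 0)) (![b,c,d,e,f] (σ 1)) g)
          (![b,c,d,e,f] (σ 2))) (![b,c,d,e,f] (σ 3)) (![b,c,d,e,f] (σ 4)))
    + (∑ σ : Equiv.Perm (Fin 5), (Equiv.Perm.sign σ : ℤ) •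
        A.pats (A.pats a (![b,c,d,e,f] (σ 0)) (![b,c,d,e,f] (σ 1)))
          (A.pats (![b,c,d,e,f] (σ 2)) (![b,c,d,e,f] (σ 3)) (![b,c,d,e,f] (σ 4))) g)
    - (2 : ℤ) • (∑ σ : Equiv.Perm (Fin 5), (Equiv.Perm.sign σ : ℤ) •
        A.pats a (A.pats (A.pats (![b,c,d,e,f] (σ 0)) (![b,c,d,e,f] (σ 1))
          (![b,c,d,e,f] (σ 2))) (![b,c,d,e,f] (σ 3)) g) (![b,c,d,e,f] (σ 4)))
    - (∑ σ : Equiv.Perm (Fin 5), (Equiv.Perm.sign σ : ℤ) •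
        A.pats a (A.pats b (![c,d,e,f,g] (σ 0)) (![c,d,e,f,g] (σ 1)))
          (A.pats (![c,d,e,f,g] (σ 2)) (![c,d,e,f,g] (σ 3)) (![c,d,e,f,g] (σ 4))))
    = 0 := by
  rw [A.sum_pats_pats_pats_first_eq_last, A.sum_pats_pats_pats_left a g ![b,c,d,e,f],
    A.sum_pats_pats_middle_last a g ![b,c,d,e,f], A.sum_pats_pats_middle a g ![b,c,d,e,f],
    A.sum_pats_pats_pats_last a g ![b,c,d,e,f], A.sum_pats_pats_pats_middle a g ![b,c,d,e,f],
    A.sum_pats_pats_pats a g ![b,c,d,e,f], ← A.sum_sign_smul_half_identity a g ![b,c,d,e,f]]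
  simp only [smul_add, Finset.sum_add_distrib, smul_comm _ (12 : ℤ), smul_comm _ (4 : ℤ),
    smul_comm _ (-4 : ℤ), ← Finset.smul_sum]
  module
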